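/- arXiv:2409.08727 — 6 statements merged into one kernel-verified Lean document; each statement's English description precedes it below -/
import Mathlib

section
/- Let Γ be an alphabet and B be a zero-sum-free strong bimonoid. Then the following two statements are equivalent: (1) B is strongly zero-sum-free; (2) for each weighted automaton A over Γ and B, supp(⟦A⟧^run) = supp(⟦A⟧^init). -/
/-! Strong bimonoids -/

structure StrongBimonoid (B : Type) where
  add : B → B → B
  mul : B → B → B
  zero : B
  one : B
  add_assoc : ∀ a b c, add (add a b) c = add a (add b c)
  add_comm : ∀ a b, add a b = add b a
  add_zero : ∀ a, add a zero = a
  mul_assoc : ∀ a b c, mul (mul a b) c = mul a (mul b c)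
  one_mul : ∀ a, mul one a = a
  mul_one : ∀ a, mul a one = a
  zero_mul : ∀ a, mul zero a = zero
  mul_zero : ∀ a, mul a zero = zero

namespace StrongBimonoid

variable {B : Type} (S : StrongBimonoid B)

/-- The additive commutative monoid underlying a strong bimonoid. -/
def acm : AddCommMonoid B where
  add := S.add
  zero := S.zero
  add_assoc := S.add_assoc
  zero_add := fun a => (S.add_comm S.zero a).trans (S.add_zero a)
  add_zero := S.add_zero
  add_comm := S.add_comm
  nsmul := fun n a => Nat.rec S.zero (fun _ ih => S.add ih a) n
  nsmul_zero := fun _ => rfl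
  nsmul_succ := fun _ _ => rfl

/-- Finite sum (w.r.t. `S.add`, `S.zero`) of `f` over a finite index set. -/
def fsum {ι : Type} (t : Finset ι) (f : ι → B) : B :=
  @Finset.sum ι B S.acm t f

/-- Ordered product `f 0 ⊗ f 1 ⊗ ⋯ ⊗ f (k-1)` (empty product is `S.one`). -/
def finProd : {k : ℕ} → (Fin k → B) → B
  | 0, _ => S.one
  | _ + 1, f => S.mul (f 0) (finProd (fun i => f i.succ))

def ZeroSumFree : Prop :=
  ∀ a b, S.add a b = S.zero → a = S.zero ∧ b = S.zero

def StronglyZeroSumFree : Prop :=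
  ∀ a b c, S.mul (S.add a b) c = S.zero ↔ (S.mul a c = S.zero ∧ S.mul b c = S.zero)

def BiStronglyZeroSumFree : Prop :=
  ∀ a b b' c, S.mul (S.mul a (S.add b b')) c = S.zero ↔
    (S.mul (S.mul a b) c = S.zero ∧ S.mul (S.mul a b') c = S.zero)

def ZeroDivisorFree : Prop :=
  ∀ a b, S.mul a b = S.zero ↔ (a = S.zero ∨ b = S.zero)

def Positive : Prop := S.ZeroSumFree ∧ S.ZeroDivisorFree

def RightDistributive : Prop :=
  ∀ a b c, S.mul (S.add a b) c = S.add (S.mul a c) (S.mul b c)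

def LeftDistributive : Prop :=
  ∀ a b c, S.mul a (S.add b c) = S.add (S.mul a b) (S.mul a c)

def ZeroRightDistributive : Prop :=
  ∀ a b c, (S.mul (S.add a b) c = S.zero ↔ S.add (S.mul a c) (S.mul b c) = S.zero)

def CommutativeMul : Prop := ∀ a b, S.mul a b = S.mul b a

end StrongBimonoid

/-! Weighted automata over words -/

section Word

variable {B : Type} {Γ : Type} {Q : Type}

/-- The product `μ(a₁)_{ρ₀,ρ₁} ⊗ ⋯ ⊗ μ(aₙ)_{ρₙ₋₁,ρₙ}` of the transition weights
along the run `ρ` on the word `w = a₁⋯aₙ`. -/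
def transProd (S : StrongBimonoid B) (μ : Γ → Q → Q → B) :
    (w : List Γ) → (Fin (w.length + 1) → Q) → B
  | [], _ => S.one
  | a :: w, ρ => S.mul (μ a (ρ 0) (ρ 1)) (transProd S μ w (fun i => ρ i.succ))

/-- Run semantics of the weighted automaton `(Q, I, μ, F)` over `Γ` and `S`. -/
def runSem (S : StrongBimonoid B) [Fintype Q] (I : Q → B) (μ : Γ → Q → Q → B)
    (F : Q → B) (w : List Γ) : B :=
  S.fsum Finset.univ (fun ρ : Fin (w.length + 1) → Q =>
    S.mul (S.mul (I (ρ 0)) (transProd S μ w ρ)) (F (ρ (Fin.last w.length))))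

/-- `hWord S μ w v` is the vector `v ⊗ μ(a₁) ⊗ ⋯ ⊗ μ(aₙ)` (left-associated
vector-matrix products) for `w = a₁⋯aₙ`. -/
def hWord (S : StrongBimonoid B) [Fintype Q] (μ : Γ → Q → Q → B) :
    List Γ → (Q → B) → (Q → B)
  | [], v => v
  | a :: w, v =>
      hWord S μ w (fun q => S.fsum Finset.univ (fun p => S.mul (v p) (μ a p q)))

/-- Initial algebra semantics of the weighted automaton `(Q, I, μ, F)`. -/
def initSem (S : StrongBimonoid B) [Fintype Q] (I : Q → B) (μ : Γ → Q → Q → B)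
    (F : Q → B) (w : List Γ) : B :=
  S.fsum Finset.univ (fun q => S.mul (hWord S μ w I q) (F q))

end Word

/-! Ranked alphabets, trees and weighted tree automata -/

/-- Trees over the ranked alphabet `(σ, rk)`: a node labelled `s` has exactly
`rk s` children. -/
inductive RTree (σ : Type) (rk : σ → ℕ) : Type where
  | node (s : σ) (ts : Fin (rk s) → RTree σ rk) : RTree σ rk

/-- The ranked alphabet is trivial if all symbols have rank 0. -/
def RankTrivial {σ : Type} (rk : σ → ℕ) : Prop := ∀ s, rk s = 0

/-- The ranked alphabet is branching if some symbol has rank ≥ 2. -/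
def RankBranching {σ : Type} (rk : σ → ℕ) : Prop := ∃ s, 2 ≤ rk s

/-- A run of an automaton with state set `Q` on a tree: an assignment of a
state to every position of the tree. -/
inductive TreeRun (σ : Type) (rk : σ → ℕ) (Q : Type) : RTree σ rk → Type where
  | node {s : σ} {ts : Fin (rk s) → RTree σ rk} (q : Q)
      (rs : (i : Fin (rk s)) → TreeRun σ rk Q (ts i)) :
      TreeRun σ rk Q (RTree.node s ts)

/-- The state assigned by a run to the root. -/
def TreeRun.root {σ : Type} {rk : σ → ℕ} {Q : Type} {t : RTree σ rk} :
    TreeRun σ rk Q t → Q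
  | .node q _ => q

def treeRunFintype {σ : Type} {rk : σ → ℕ} (Q : Type) [Fintype Q] :
    (t : RTree σ rk) → Fintype (TreeRun σ rk Q t)
  | RTree.node s ts =>
    letI : ∀ i, Fintype (TreeRun σ rk Q (ts i)) := fun i => treeRunFintype Q (ts i)
    Fintype.ofEquiv (Q × ((i : Fin (rk s)) → TreeRun σ rk Q (ts i)))
      { toFun := fun p => TreeRun.node p.1 p.2
        invFun := fun r => match r with | TreeRun.node q rs => (q, rs)
        left_inv := fun _ => rfl
        right_inv := fun r => match r with | TreeRun.node _ _ => rfl }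

instance {σ : Type} {rk : σ → ℕ} {Q : Type} [Fintype Q] (t : RTree σ rk) :
    Fintype (TreeRun σ rk Q t) := treeRunFintype Q t

/-- The weight of a run on a tree. -/
def treeWt {B : Type} {σ : Type} {rk : σ → ℕ} {Q : Type} (S : StrongBimonoid B)
    (δ : (s : σ) → (Fin (rk s) → Q) → Q → B) :
    (t : RTree σ rk) → TreeRun σ rk Q t → B
  | _, TreeRun.node (s := s) (ts := ts) q rs =>
      S.mul (S.finProd (fun i => treeWt S δ (ts i) (rs i)))
        (δ s (fun i => (rs i).root) q)

/-- Run semantics of the weighted tree automaton `(Q, δ, F)`. -/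
def treeRunSem {B : Type} {σ : Type} {rk : σ → ℕ} {Q : Type} (S : StrongBimonoid B)
    [Fintype Q] (δ : (s : σ) → (Fin (rk s) → Q) → Q → B) (F : Q → B)
    (t : RTree σ rk) : B :=
  S.fsum Finset.univ (fun ρ : TreeRun σ rk Q t => S.mul (treeWt S δ t ρ) (F ρ.root))

/-- The map `h_A : T_Σ → B^Q` of the initial algebra semantics. -/
def treeH {B : Type} {σ : Type} {rk : σ → ℕ} {Q : Type} (S : StrongBimonoid B)
    [Fintype Q] (δ : (s : σ) → (Fin (rk s) → Q) → Q → B) :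
    RTree σ rk → Q → B
  | RTree.node s ts => fun q =>
      S.fsum Finset.univ (fun qs : Fin (rk s) → Q =>
        S.mul (S.finProd (fun i => treeH S δ (ts i) (qs i))) (δ s qs q))

/-- Initial algebra semantics of the weighted tree automaton `(Q, δ, F)`. -/
def treeInitSem {B : Type} {σ : Type} {rk : σ → ℕ} {Q : Type} (S : StrongBimonoid B)
    [Fintype Q] (δ : (s : σ) → (Fin (rk s) → Q) → Q → B) (F : Q → B)
    (t : RTree σ rk) : B :=
  S.fsum Finset.univ (fun q => S.mul (treeH S δ t q) (F q))


theorem StrongBimonoid.fsum_insert {B ι : Type} [DecidableEq ι] (S : StrongBimonoid B)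
    {i : ι} {t : Finset ι} (hi : i ∉ t) (f : ι → B) :
    S.fsum (insert i t) f = S.add (f i) (S.fsum t f) :=
  @Finset.sum_insert ι B t i S.acm f _ hi

theorem StrongBimonoid.fsum_eq_zero_iff {B ι : Type} {S : StrongBimonoid B}
    (hS : S.ZeroSumFree) (t : Finset ι) (f : ι → B) :
    S.fsum t f = S.zero ↔ ∀ i ∈ t, f i = S.zero := by
  classical
  induction t using Finset.induction_on with
  | empty => exact ⟨fun _ i hi => absurd hi (Finset.notMem_empty i), fun _ => rfl⟩
  | insert i t hi ih =>
    rw [S.fsum_insert hi, Finset.forall_mem_insert, ← ih]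
    refine ⟨hS _ _, fun h => ?_⟩
    rw [h.1, h.2, S.add_zero]

theorem StrongBimonoid.fsum_mul_eq_zero_iff {B ι : Type} {S : StrongBimonoid B}
    (hS : S.StronglyZeroSumFree) (t : Finset ι) (f : ι → B) (c : B) :
    S.mul (S.fsum t f) c = S.zero ↔ ∀ i ∈ t, S.mul (f i) c = S.zero := by
  classical
  induction t using Finset.induction_on with
  | empty => exact ⟨fun _ i hi => absurd hi (Finset.notMem_empty i), fun _ => S.zero_mul c⟩
  | insert i t hi ih =>
    rw [S.fsum_insert hi, Finset.forall_mem_insert, ← ih]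
    exact hS _ _ _

/-- Under strong zero-sum-freeness, an entry of the initial algebra vector annihilates `c` exactly
when the weight of every run ending in the corresponding state does. -/
theorem hWord_mul_eq_zero_iff {B Γ Q : Type} [Fintype Q] {S : StrongBimonoid B}
    (hS : S.StronglyZeroSumFree) (μ : Γ → Q → Q → B) (w : List Γ) (v : Q → B) (q : Q) (c : B) :
    S.mul (hWord S μ w v q) c = S.zero ↔
      ∀ ρ : Fin (w.length + 1) → Q, ρ (Fin.last w.length) = q →
        S.mul (S.mul (v (ρ 0)) (transProd S μ w ρ)) c = S.zero := by
  induction w generalizing v with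
  | nil =>
    simp only [hWord, transProd, S.mul_one]
    refine ⟨?_, fun h => h (fun _ => q) rfl⟩
    rintro h ρ rfl
    exact h
  | cons a w ih =>
    rw [hWord, ih]
    simp only [S.mul_assoc, StrongBimonoid.fsum_mul_eq_zero_iff hS, Finset.mem_univ,
      forall_true_left, transProd]
    constructor
    · intro h ρ hρ
      exact h (fun i => ρ i.succ) hρ (ρ 0)
    · intro h ρ hρ p
      exact h (Fin.cons p ρ : Fin (w.length + 1 + 1) → Q) hρ

theorem stmt0 {B : Type} (S : StrongBimonoid B) (Γ : Type) [Fintype Γ] [Nonempty Γ]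
    (hzsf : S.ZeroSumFree) :
    S.StronglyZeroSumFree ↔
      (∀ (Q : Type) [Fintype Q] [Nonempty Q] (I : Q → B) (μ : Γ → Q → Q → B) (F : Q → B),
        {w : List Γ | runSem S I μ F w ≠ S.zero} =
          {w : List Γ | initSem S I μ F w ≠ S.zero}) := by
  have supp_iff : ∀ (Q : Type) [Fintype Q] (I : Q → B) (μ : Γ → Q → Q → B) (F : Q → B),
      {w : List Γ | runSem S I μ F w ≠ S.zero} = {w : List Γ | initSem S I μ F w ≠ S.zero} ↔
        ∀ w, (∀ ρ : Fin (w.length + 1) → Q, S.mul (S.mul (I (ρ 0)) (transProd S μ w ρ))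
            (F (ρ (Fin.last w.length))) = S.zero) ↔
          ∀ q, S.mul (hWord S μ w I q) (F q) = S.zero := by
    intro Q _ I μ F
    simp only [Set.ext_iff, Set.mem_ofPred_eq, ne_eq, not_iff_not, runSem, initSem,
      StrongBimonoid.fsum_eq_zero_iff hzsf, Finset.mem_univ, forall_true_left]
  constructor
  · intro hS Q _ _ I μ F
    rw [supp_iff]
    intro w
    simp only [hWord_mul_eq_zero_iff hS]
    refine ⟨?_, fun h ρ => h _ ρ rfl⟩
    rintro h _ ρ rfl
    exact h ρ
  · intro h a b c
    obtain ⟨γ⟩ := ‹Nonempty Γ›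
    have key := (supp_iff Bool (fun p => bif p then a else b)
      (fun _ _ q => bif q then S.one else S.zero) (fun q => bif q then c else S.zero)).1
      (h _ _ _ _) [γ]
    have hsum : ∀ f : Bool → B, S.fsum Finset.univ f = S.add (f true) (f false) := by
      intro f
      exact @Fintype.sum_bool B S.acm f
    simp only [hWord, hsum, Bool.forall_bool, cond_true, cond_false, S.mul_one, S.mul_zero,
      true_and] at key
    rw [← key]
    constructor
    · intro hρ
      have ha := hρ (fun _ => true)
      have hb := hρ (Fin.cons false (fun _ => true) : Fin 2 → Bool)
      simp only [transProd, S.mul_one, cond_true] at ha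
      exact ⟨ha, by simpa [transProd, S.mul_one] using hb⟩
    · rintro ⟨ha, hb⟩ ρ
      have hlast : ρ (Fin.last [γ].length) = ρ 1 := rfl
      rw [hlast]
      cases h0 : ρ 0 <;> cases h1 : ρ 1 <;>
        simp [transProd, h1, S.mul_one, S.mul_zero, ha, hb]
end

section
/- Let Γ be an alphabet and B be a zero-sum-free strong bimonoid. Then the following two statements are equivalent: (1) for all a,b,c ∈ B, a ⊗ c ≠ 𝟘 implies (a ⊕ b) ⊗ c ≠ 𝟘; (2) for each weighted automaton A over Γ and B, supp(⟦A⟧^run) ⊆ supp(⟦A⟧^init). -/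
namespace StrongBimonoid

variable {B ι : Type} (S : StrongBimonoid B)

theorem fsum_insert_s1 [DecidableEq ι] {t : Finset ι} {i : ι} (hi : i ∉ t) (f : ι → B) :
    S.fsum (insert i t) f = S.add (f i) (S.fsum t f) :=
  @Finset.sum_insert ι B t i S.acm f _ hi

theorem exists_fsum_eq_add [DecidableEq ι] {t : Finset ι} {i : ι} (hi : i ∈ t) (f : ι → B) :
    ∃ b, S.fsum t f = S.add (f i) b :=
  ⟨S.fsum (t.erase i) f, by rw [← S.fsum_insert_s1 (Finset.notMem_erase i t), Finset.insert_erase hi]⟩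

theorem exists_ne_zero_of_fsum_ne_zero {t : Finset ι} {f : ι → B} (h : S.fsum t f ≠ S.zero) :
    ∃ i ∈ t, f i ≠ S.zero :=
  @Finset.exists_ne_zero_of_sum_ne_zero ι B t S.acm f h

theorem ZeroSumFree.fsum_ne_zero {S : StrongBimonoid B} (hS : S.ZeroSumFree) {t : Finset ι}
    {f : ι → B} {i : ι} (hi : i ∈ t) (h : f i ≠ S.zero) : S.fsum t f ≠ S.zero := by
  classical
  obtain ⟨b, hb⟩ := S.exists_fsum_eq_add hi f
  exact fun h0 => h (hS _ _ (hb.symm.trans h0)).1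

theorem fsum_bool (f : Bool → B) : S.fsum Finset.univ f = S.add (f true) (f false) :=
  @Fintype.sum_bool B S.acm f

end StrongBimonoid

/-- If adding a summand to the left factor preserves nonzero products, then a nonzero run weight
forces the corresponding entry of the weight vector to have a nonzero product. -/
theorem hWord_mul_ne_zero {B Γ Q : Type} [Fintype Q] (S : StrongBimonoid B)
    (h : ∀ a b c : B, S.mul a c ≠ S.zero → S.mul (S.add a b) c ≠ S.zero)
    (μ : Γ → Q → Q → B) (c : B) (w : List Γ) (v : Q → B) (ρ : Fin (w.length + 1) → Q)
    (hρ : S.mul (S.mul (v (ρ 0)) (transProd S μ w ρ)) c ≠ S.zero) :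
    S.mul (hWord S μ w v (ρ (Fin.last w.length))) c ≠ S.zero := by
  classical
  induction w generalizing v with
  | nil => simpa [transProd, hWord, S.mul_one] using hρ
  | cons a w ih =>
    refine ih _ (fun i => ρ i.succ) ?_
    obtain ⟨b, hb⟩ := S.exists_fsum_eq_add (Finset.mem_univ (ρ 0))
      fun p => S.mul (v p) (μ a p (ρ 1))
    change S.mul (S.mul (S.fsum Finset.univ fun p => S.mul (v p) (μ a p (ρ 1))) _) c ≠ S.zero
    rw [hb, S.mul_assoc]
    apply h
    simpa only [transProd, S.mul_assoc] using hρ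

theorem stmt1 {B : Type} (S : StrongBimonoid B) (Γ : Type) [Fintype Γ] [Nonempty Γ]
    (hzsf : S.ZeroSumFree) :
    (∀ a b c : B, S.mul a c ≠ S.zero → S.mul (S.add a b) c ≠ S.zero) ↔
      (∀ (Q : Type) [Fintype Q] [Nonempty Q] (I : Q → B) (μ : Γ → Q → Q → B) (F : Q → B),
        {w : List Γ | runSem S I μ F w ≠ S.zero} ⊆
          {w : List Γ | initSem S I μ F w ≠ S.zero}) := by
  constructor
  · intro h Q _ _ I μ F w hw
    obtain ⟨ρ, -, hρ⟩ := S.exists_ne_zero_of_fsum_ne_zero hw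
    exact hzsf.fsum_ne_zero (Finset.mem_univ _) (hWord_mul_ne_zero S h μ _ w I ρ hρ)
  · intro h a b c hac h0
    obtain ⟨x⟩ := ‹Nonempty Γ›
    refine h Bool (fun p => cond p a b) (fun _ _ _ => S.one) (fun q => cond q c S.zero)
      (a := [x]) ?_ ?_
    · refine hzsf.fsum_ne_zero (Finset.mem_univ fun _ => true) ?_
      simpa [transProd, S.mul_one] using hac
    · simp [initSem, hWord, -Fintype.univ_bool, S.fsum_bool, S.mul_one, S.mul_zero, S.add_zero, h0]
end

section
/- Let Γ be an alphabet and let B be a strong bimonoid. If B is positive or right-distributive, then for each weighted automaton A over Γ and B, supp(⟦A⟧^run) = supp(⟦A⟧^init). -/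
namespace StrongBimonoid

theorem RightDistributive.fsum_mul {B : Type} {S : StrongBimonoid B} (h : S.RightDistributive)
    {ι : Type} (t : Finset ι) (f : ι → B) (c : B) :
    S.mul (S.fsum t f) c = S.fsum t (fun i => S.mul (f i) c) := by
  classical
  let _ := S.acm
  induction t using Finset.induction_on with
  | empty => exact S.zero_mul c
  | insert i t hi ih =>
    simp only [fsum] at ih ⊢
    rw [Finset.sum_insert hi, Finset.sum_insert hi, ← ih]
    exact h _ _ _

theorem ZeroSumFree.fsum_eq_zero_iff {B : Type} {S : StrongBimonoid B} (h : S.ZeroSumFree)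
    {ι : Type} (t : Finset ι) (f : ι → B) :
    S.fsum t f = S.zero ↔ ∀ i ∈ t, f i = S.zero := by
  classical
  let _ := S.acm
  refine ⟨fun ht => ?_, fun ht => Finset.sum_eq_zero ht⟩
  induction t using Finset.induction_on with
  | empty => simp
  | insert i t hi ih =>
    simp only [fsum] at ih ht
    rw [Finset.sum_insert hi] at ht
    obtain ⟨h₁, h₂⟩ := h _ _ ht
    intro j hj
    rcases Finset.mem_insert.mp hj with rfl | hj
    · exact h₁
    · exact ih h₂ j hj

end StrongBimonoid

theorem runSem_cons {B Γ Q : Type} (S : StrongBimonoid B) [Fintype Q] (I : Q → B)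
    (μ : Γ → Q → Q → B) (F : Q → B) (a : Γ) (w : List Γ) :
    runSem S I μ F (a :: w) =
      S.fsum Finset.univ (fun ρ : Fin (w.length + 1) → Q => S.fsum Finset.univ (fun p =>
        S.mul (S.mul (S.mul (I p) (μ a p (ρ 0))) (transProd S μ w ρ))
          (F (ρ (Fin.last w.length))))) := by
  let _ := S.acm
  simp only [StrongBimonoid.fsum]
  rw [← Fintype.sum_prod_type_right']
  symm
  refine Fintype.sum_equiv (Fin.consEquiv (fun _ : Fin (w.length + 1 + 1) => Q)) _ _ ?_
  rintro ⟨p, ρ⟩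
  rw [S.mul_assoc (I p)]
  rfl

theorem runSem_nil {B Γ Q : Type} (S : StrongBimonoid B) [Fintype Q] (I : Q → B)
    (μ : Γ → Q → Q → B) (F : Q → B) :
    runSem S I μ F [] = initSem S I μ F [] := by
  let _ := S.acm
  refine Fintype.sum_equiv (Equiv.funUnique (Fin 1) Q) _ _ fun ρ => ?_
  change S.mul (S.mul (I (ρ 0)) S.one) (F (ρ 0)) = S.mul (I (ρ 0)) (F (ρ 0))
  rw [S.mul_one]

theorem runSem_eq_initSem {B Γ Q : Type} {S : StrongBimonoid B} (h : S.RightDistributive)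
    [Fintype Q] (I : Q → B) (μ : Γ → Q → Q → B) (F : Q → B) (w : List Γ) :
    runSem S I μ F w = initSem S I μ F w := by
  induction w generalizing I with
  | nil => exact runSem_nil S I μ F
  | cons a w ih =>
    rw [runSem_cons]
    simp only [← h.fsum_mul]
    exact ih (fun q => S.fsum Finset.univ (fun p => S.mul (I p) (μ a p q)))

theorem runSem_eq_zero_iff_initSem_eq_zero {B Γ Q : Type} {S : StrongBimonoid B}
    (h : S.Positive) [Fintype Q] (I : Q → B) (μ : Γ → Q → Q → B) (F : Q → B) (w : List Γ) :
    runSem S I μ F w = S.zero ↔ initSem S I μ F w = S.zero := by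
  obtain ⟨hs, hd⟩ := h
  induction w generalizing I with
  | nil => rw [runSem_nil]
  | cons a w ih =>
    refine Iff.trans ?_ (ih (fun q => S.fsum Finset.univ (fun p => S.mul (I p) (μ a p q))))
    rw [runSem_cons, runSem]
    simp only [hs.fsum_eq_zero_iff, hd _ _, Finset.mem_univ, true_imp_iff, forall_or_right]

theorem stmt3 {B : Type} (S : StrongBimonoid B) (Γ : Type) [Fintype Γ] [Nonempty Γ]
    (h : S.Positive ∨ S.RightDistributive) :
    ∀ (Q : Type) [Fintype Q] [Nonempty Q] (I : Q → B) (μ : Γ → Q → Q → B) (F : Q → B),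
      {w : List Γ | runSem S I μ F w ≠ S.zero} =
        {w : List Γ | initSem S I μ F w ≠ S.zero} := by
  intro Q _ _ I μ F
  ext w
  rcases h with h | h
  · exact not_congr (runSem_eq_zero_iff_initSem_eq_zero h I μ F w)
  · exact not_congr (by rw [runSem_eq_initSem h])
end

section
/- Let ⊗ be a multiplication operation on ℕ such that (ℕ, +, ⊗, 0, 1) is a strongly zero-sum-free strong bimonoid (where + is the usual addition of natural numbers). Then (ℕ, +, ⊗, 0, 1) is positive. -/
theorem stmt8 (S : StrongBimonoid ℕ) (hadd : S.add = fun a b => a + b)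
    (hzero : S.zero = 0) (hone : S.one = 1)
    (h : S.StronglyZeroSumFree) : S.Positive := by
  refine ⟨fun a b hab => ?_, fun a b => ⟨fun hab => ?_, ?_⟩⟩
  · simpa [hadd, hzero] using hab
  · rcases a with _ | n
    · exact Or.inl hzero.symm
    · right
      have hn : S.mul (S.add n S.one) b = S.zero := by simpa [hadd, hone] using hab
      simpa [S.one_mul] using ((h n S.one b).1 hn).2
  · rintro (rfl | rfl)
    · exact S.zero_mul b
    · exact S.mul_zero a
end

section
/- Each strongly zero-sum-free commutative strong bimonoid is bi-strongly zero-sum-free, and each strongly zero-sum-free left-distributive strong bimonoid is bi-strongly zero-sum-free. -/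
theorem stmt11 {B : Type} (S : StrongBimonoid B) :
    (S.StronglyZeroSumFree → S.CommutativeMul → S.BiStronglyZeroSumFree) ∧
    (S.StronglyZeroSumFree → S.LeftDistributive → S.BiStronglyZeroSumFree) := by
  refine ⟨fun h comm a b b' c => ?_, fun h distrib a b b' c => ?_⟩
  · rw [comm a (S.add b b'), comm a b, comm a b', S.mul_assoc, S.mul_assoc, S.mul_assoc]
    exact h b b' (S.mul a c)
  · rw [distrib]
    exact h (S.mul a b) (S.mul a b') c
end

section
/- Let B be the set of all functions f : ℕ → ℕ with f(0) = 0, equipped with pointwise addition ⊕ (i.e. (f ⊕ g)(n) = f(n) + g(n)), composition ∘ as multiplication, the constant-zero function as 𝟘, and the identity function as 𝟙. Then B is a right-distributive, zero-sum-free strong bimonoid which is not bi-strongly zero-sum-free. -/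
theorem stmt12 :
    ∃ S : StrongBimonoid {f : ℕ → ℕ // f 0 = 0},
      S.add = (fun f g => ⟨fun n => f.1 n + g.1 n, by simp [f.2, g.2]⟩) ∧
      S.mul = (fun f g => ⟨fun n => f.1 (g.1 n), by simp [f.2, g.2]⟩) ∧
      S.zero = ⟨fun _ => 0, rfl⟩ ∧
      S.one = ⟨fun n => n, rfl⟩ ∧
      S.RightDistributive ∧ S.ZeroSumFree ∧ ¬ S.BiStronglyZeroSumFree := by
  refine ⟨{
    add := fun f g => ⟨fun n => f.1 n + g.1 n, by simp [f.2, g.2]⟩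
    mul := fun f g => ⟨fun n => f.1 (g.1 n), by simp [f.2, g.2]⟩
    zero := ⟨fun _ => 0, rfl⟩
    one := ⟨fun n => n, rfl⟩
    add_assoc := fun a b c => Subtype.ext (funext fun n => Nat.add_assoc _ _ _)
    add_comm := fun a b => Subtype.ext (funext fun n => Nat.add_comm _ _)
    add_zero := fun _ => rfl
    mul_assoc := fun _ _ _ => rfl
    one_mul := fun _ => rfl
    mul_one := fun _ => rfl
    zero_mul := fun _ => rfl
    mul_zero := fun a => Subtype.ext (funext fun _ => a.2) }, rfl, rfl, rfl, rfl, ?_, ?_, ?_⟩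
  · exact fun _ _ _ => rfl
  · intro a b h
    have sum_eq_zero (n : ℕ) : a.1 n + b.1 n = 0 := congrFun (congrArg Subtype.val h) n
    exact ⟨Subtype.ext (funext fun n => Nat.eq_zero_of_add_eq_zero_right (sum_eq_zero n)),
      Subtype.ext (funext fun n => Nat.eq_zero_of_add_eq_zero_left (sum_eq_zero n))⟩
  · intro h
    -- The predecessor kills the indicator of the positive numbers, but not its double.
    have pred_min (n : ℕ) : min n 1 - 1 = 0 := by omega
    have double := (h ⟨fun n => n - 1, rfl⟩ ⟨fun n => min n 1, rfl⟩ ⟨fun n => min n 1, rfl⟩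
      ⟨fun n => n, rfl⟩).2
      ⟨Subtype.ext (funext pred_min), Subtype.ext (funext pred_min)⟩
    exact one_ne_zero (congrFun (congrArg Subtype.val double) 1 : (1 : ℕ) = 0)
end
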